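/- Let (··|··) be a perfect k-hyperbolic path crossratio (with path constant k) on a set M. Then there exists a constant p ≥ 0 such that for all pairwise distinct a, b, c ∈ M there is a sequence (x_i)_{i∈ℤ} of pairwise distinct points of M \ {a,b} with x₀ = c and |(b x_i | a x_j) − (j − i)| ≤ p for all integers i < j. -/

import Mathlib

open Set Filter Topology

/-- Four pairwise distinct points. -/
def PDist4 {M : Type*} (x y z w : M) : Prop :=
  x ≠ y ∧ x ≠ z ∧ x ≠ w ∧ y ≠ z ∧ y ≠ w ∧ z ≠ w

/-- Five pairwise distinct points. -/
def PDist5 {M : Type*} (x y z w u : M) : Prop :=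
  PDist4 x y z w ∧ x ≠ u ∧ y ≠ u ∧ z ≠ u ∧ w ≠ u

/-- A crossratio on a set `M`: a nonnegative function on quadruples of pairwise distinct
points satisfying the symmetries `(xy|zw) = (yx|zw) = (zw|xy)`. -/
def IsCrossratio {M : Type*} (cr : M → M → M → M → ℝ) : Prop :=
  ∀ x y z w : M, PDist4 x y z w →
    0 ≤ cr x y z w ∧ cr x y z w = cr y x z w ∧ cr x y z w = cr z w x y

/-- `(p,q | r,s)` is equivalent under the symmetries of the crossratio to `(x,y | z,w)`:
the unordered pair of unordered pairs coincide. -/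
def SamePair {M : Type*} (p q r s x y z w : M) : Prop :=
  (({p, q} : Set M) = {x, y} ∧ ({r, s} : Set M) = {z, w}) ∨
  (({p, q} : Set M) = {z, w} ∧ ({r, s} : Set M) = {x, y})

/-- A crossratio is `k`-hyperbolic (Bowditch). -/
def IsHyperbolicCR {M : Type*} (cr : M → M → M → M → ℝ) (k : ℝ) : Prop :=
  (∀ a b c d : M, PDist4 a b c d →
    ∃ x y z w : M, PDist4 x y z w ∧ ({x, y, z, w} : Set M) = {a, b, c, d} ∧
      |cr x z y w| ≤ k ∧ |cr x w y z| ≤ k) ∧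
  (∀ a b c d e : M, PDist5 a b c d e →
    ∃ x y z w u : M, PDist5 x y z w u ∧ ({x, y, z, w, u} : Set M) = {a, b, c, d, e} ∧
      |cr x y z u - cr x y w u| ≤ k ∧
      |cr x u z w - cr y u z w| ≤ k ∧
      |cr x y z w - (cr x y z u + cr x u z w)| ≤ k ∧
      (∀ p q r s : M, PDist4 p q r s →
        p ∈ ({x, y, z, w, u} : Set M) → q ∈ ({x, y, z, w, u} : Set M) →
        r ∈ ({x, y, z, w, u} : Set M) → s ∈ ({x, y, z, w, u} : Set M) →
        ¬ SamePair p q r s x y z u → ¬ SamePair p q r s x y w u →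
        ¬ SamePair p q r s x u z w → ¬ SamePair p q r s y u z w →
        ¬ SamePair p q r s x y z w →
        |cr p q r s| ≤ k))

/-- A `k`-hyperbolic crossratio is a path crossratio with constant `k`: any two points `y, w`
can be joined, relative to any other two points `x, z`, by a finite chain `u₀ = y, …, u_n = w`
with `(x u_i | z u_j) ≃_k j - i` for `i < j` (all displayed crossratios being defined). -/
def IsPathCR {M : Type*} (cr : M → M → M → M → ℝ) (k : ℝ) : Prop :=
  ∀ x y z w : M, PDist4 x y z w →
    ∃ n : ℕ, ∃ u : Fin (n + 1) → M, u 0 = y ∧ u (Fin.last n) = w ∧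
      Function.Injective u ∧ (∀ i, u i ≠ x ∧ u i ≠ z) ∧
      ∀ i j : Fin (n + 1), i < j →
        |cr x (u i) z (u j) - (((j : ℕ) : ℝ) - ((i : ℕ) : ℝ))| ≤ k

/-- A crossratio is perfect: for all distinct `x, y, z` there is a sequence `x_i` avoiding
`x, y, z` with `(yz | x x_i) → ∞`. -/
def IsPerfectCR {M : Type*} (cr : M → M → M → M → ℝ) : Prop :=
  ∀ x y z : M, x ≠ y → x ≠ z → y ≠ z →
    ∃ s : ℕ → M, (∀ i, s i ≠ x ∧ s i ≠ y ∧ s i ≠ z) ∧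
      Tendsto (fun i => cr y z x (s i)) atTop atTop

set_option maxHeartbeats 4000000 in
/-- A crossratio-like function satisfying the crossratio symmetries on all quadruples, whose values
on a five-point set are those of a tree with cherries `x, y` and `z, w` up to an error `k`, satisfies
the cocycle identity for signed distances of projections to the line `a b`. -/
lemma cocycle_of_tree_approx {M : Type*} {f : M → M → M → M → ℝ} {k : ℝ}
    (h1 : ∀ x y z w, f x y z w = f y x z w) (h2 : ∀ x y z w, f x y z w = f z w x y)
    {x y z w u : M} {s t : ℝ}
    (e1 : |f x y z u - s| ≤ k) (e2 : |f x y w u - s| ≤ k)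
    (e3 : |f x u z w - t| ≤ k) (e4 : |f y u z w - t| ≤ k) (e5 : |f x y z w - (s + t)| ≤ k)
    (z1 : |f x z y w| ≤ k) (z2 : |f x w y z| ≤ k)
    (z3 : |f x z y u| ≤ k) (z4 : |f x u y z| ≤ k)
    (z5 : |f x w y u| ≤ k) (z6 : |f x u y w| ≤ k)
    (z7 : |f x z w u| ≤ k) (z8 : |f x w z u| ≤ k)
    (z9 : |f y z w u| ≤ k) (z10 : |f y w z u| ≤ k)
    {a b p q r : M} (hd : PDist5 a b p q r)
    (ha : a = x ∨ a = y ∨ a = z ∨ a = w ∨ a = u) (hb : b = x ∨ b = y ∨ b = z ∨ b = w ∨ b = u)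
    (hp : p = x ∨ p = y ∨ p = z ∨ p = w ∨ p = u) (hq : q = x ∨ q = y ∨ q = z ∨ q = w ∨ q = u)
    (hr : r = x ∨ r = y ∨ r = z ∨ r = w ∨ r = u) :
    |(f b p a q - f b q a p) + (f b q a r - f b r a q) + (f b r a p - f b p a r)| ≤ 6 * k := by
  have h3 : ∀ x y z w, f x y z w = f x y w z := fun x y z w => by
    rw [h2 x y z w, h1 z w x y, h2 w z x y]
  obtain ⟨⟨hab, hap, haq, hbp, hbq, hpq⟩, har, hbr, hpr, hqr⟩ := hd
  rw [abs_le] at e1 e2 e3 e4 e5 z1 z2 z3 z4 z5 z6 z7 z8 z9 z10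
  rcases ha with ha | ha | ha | ha | ha <;> rcases hb with hb | hb | hb | hb | hb <;>
    (first
      | exact absurd (ha.trans hb.symm) hab
      | skip) <;>
    rcases hp with hp | hp | hp | hp | hp <;>
    (first
      | exact absurd (ha.trans hp.symm) hap
      | exact absurd (hb.trans hp.symm) hbp
      | skip) <;>
    rcases hq with hq | hq | hq | hq | hq <;>
    (first
      | exact absurd (ha.trans hq.symm) haq
      | exact absurd (hb.trans hq.symm) hbq
      | exact absurd (hp.trans hq.symm) hpq
      | skip) <;>
    rcases hr with hr | hr | hr | hr | hr <;>
    (first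
      | exact absurd (ha.trans hr.symm) har
      | exact absurd (hb.trans hr.symm) hbr
      | exact absurd (hp.trans hr.symm) hpr
      | exact absurd (hq.trans hr.symm) hqr
      | (rw [ha, hb, hp, hq, hr, abs_le]
         try simp only [h1, h2, h3]
         constructor <;> linarith))

/-- A crossratio agrees on quadruples of distinct points with a function satisfying the crossratio
symmetries on all quadruples. -/
lemma IsCrossratio.exists_symm_extension {M : Type*} {cr : M → M → M → M → ℝ}
    (hcr : IsCrossratio cr) :
    ∃ f : M → M → M → M → ℝ, (∀ {x y z w}, PDist4 x y z w → cr x y z w = f x y z w) ∧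
      (∀ x y z w, f x y z w = f y x z w) ∧ (∀ x y z w, f x y z w = f z w x y) := by
  classical
  let f : M → M → M → M → ℝ := fun x y z w => if PDist4 x y z w then cr x y z w else 0
  have hf : ∀ {x y z w}, PDist4 x y z w → cr x y z w = f x y z w := fun h => (if_pos h).symm
  have s1 : ∀ x y z w, f x y z w = f y x z w := by
    intro x y z w
    by_cases h : PDist4 x y z w
    · have h' : PDist4 y x z w := by unfold PDist4 at *; tauto
      rw [← hf h, ← hf h', (hcr x y z w h).2.1]
    · have h' : ¬ PDist4 y x z w := by unfold PDist4 at *; tauto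
      simp only [f, if_neg h, if_neg h']
  have s2 : ∀ x y z w, f x y z w = f z w x y := by
    intro x y z w
    by_cases h : PDist4 x y z w
    · have h' : PDist4 z w x y := by unfold PDist4 at *; tauto
      rw [← hf h, ← hf h', (hcr x y z w h).2.2]
    · have h' : ¬ PDist4 z w x y := by unfold PDist4 at *; tauto
      simp only [f, if_neg h, if_neg h']
  exact ⟨f, hf, s1, s2⟩

/-- The signed distance between the projections of points to the line `a b`, as measured by a
hyperbolic crossratio, is a quasi-cocycle. -/
lemma IsHyperbolicCR.cocycle {M : Type*} {cr : M → M → M → M → ℝ} {k : ℝ} (hk : 0 ≤ k)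
    (hcr : IsCrossratio cr) (hhyp : IsHyperbolicCR cr k) {a b p q r : M}
    (hd : PDist5 a b p q r) :
    |(cr b p a q - cr b q a p) + (cr b q a r - cr b r a q) + (cr b r a p - cr b p a r)| ≤
      6 * k := by
  obtain ⟨x, y, z, w, u, hD, hset, h1, h2, h3, h4⟩ := hhyp.2 a b p q r hd
  obtain ⟨f, hf, s1, s2⟩ := hcr.exists_symm_extension
  have hmem : ∀ v ∈ ({a, b, p, q, r} : Set M), v = x ∨ v = y ∨ v = z ∨ v = w ∨ v = u := by
    intro v hv
    rw [← hset] at hv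
    simpa using hv
  have hd' := hd
  obtain ⟨⟨hab, hap, haq, hbp, hbq, hpq⟩, har, hbr, hpr, hqr⟩ := hd'
  obtain ⟨⟨hxy, hxz, hxw, hyz, hyw, hzw⟩, hxu, hyu, hzu, hwu⟩ := hD
  have P1 : ∀ {a b c d : M}, a ≠ b → a ≠ c → a ≠ d → b ≠ c → b ≠ d → c ≠ d → PDist4 a b c d :=
    fun h1 h2 h3 h4 h5 h6 => ⟨h1, h2, h3, h4, h5, h6⟩
  rw [hf (P1 hbp hab.symm hbq hap.symm hpq haq), hf (P1 hbq hab.symm hbp haq.symm hpq.symm hap),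
    hf (P1 hbq hab.symm hbr haq.symm hqr har), hf (P1 hbr hab.symm hbq har.symm hqr.symm haq),
    hf (P1 hbr hab.symm hbp har.symm hpr.symm hap), hf (P1 hbp hab.symm hbr hap.symm hpr har)]
  refine cocycle_of_tree_approx s1 s2 (x := x) (y := y) (z := z) (w := w) (u := u)
    (s := cr x y z u) (t := cr x u z w) ?_ ?_ ?_ ?_ ?_ ?_ ?_ ?_ ?_ ?_ ?_ ?_ ?_ ?_ ?_ hd
    (hmem a (by simp)) (hmem b (by simp)) (hmem p (by simp)) (hmem q (by simp))
    (hmem r (by simp))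
  · rw [← hf (P1 hxy hxz hxu hyz hyu hzu)]; simpa using hk
  · rw [← hf (P1 hxy hxw hxu hyw hyu hwu), abs_sub_comm]; exact h1
  · rw [← hf (P1 hxu hxz hxw hzu.symm hwu.symm hzw)]; simpa using hk
  · rw [← hf (P1 hyu hyz hyw hzu.symm hwu.symm hzw), abs_sub_comm]; exact h2
  · rw [← hf (P1 hxy hxz hxw hyz hyw hzw)]; exact h3
  all_goals
    rw [← hf (by simp [PDist4, hxy, hxz, hxw, hxu, hyz, hyw, hyu, hzw, hzu, hwu,
      hyz.symm, hyw.symm, hyu.symm, hzw.symm, hzu.symm, hwu.symm])]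
    apply h4 <;> simp [PDist4, SamePair, Set.pair_eq_pair_iff, hxy, hxz, hxw, hxu, hyz, hyw, hyu,
      hzw, hzu, hwu, hxy.symm, hxz.symm, hxw.symm, hxu.symm, hyz.symm, hyw.symm, hyu.symm,
      hzw.symm, hzu.symm, hwu.symm]

/-- At least two of the three crossratios of a quadruple are small. -/
lemma IsHyperbolicCR.two_small {M : Type*} {cr : M → M → M → M → ℝ} {k : ℝ}
    (hcr : IsCrossratio cr) (hhyp : IsHyperbolicCR cr k) {a b u v : M} (hd : PDist4 a b u v) :
    (cr b u a v ≤ k ∧ cr b v a u ≤ k) ∨ (cr a b u v ≤ k ∧ cr b v a u ≤ k) ∨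
      (cr a b u v ≤ k ∧ cr b u a v ≤ k) := by
  obtain ⟨x, y, z, w, hD, hset, e1, e2⟩ := hhyp.1 a b u v hd
  obtain ⟨f, hf, s1, s2⟩ := hcr.exists_symm_extension
  have s3 : ∀ x y z w, f x y z w = f x y w z := fun x y z w => by
    rw [s2 x y z w, s1 z w x y, s2 w z x y]
  have hmem : ∀ v' ∈ ({a, b, u, v} : Set M), v' = x ∨ v' = y ∨ v' = z ∨ v' = w := by
    intro v' hv
    rw [← hset] at hv
    simpa using hv
  have ha := hmem a (by simp)
  have hb := hmem b (by simp)
  have hu := hmem u (by simp)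
  have hv := hmem v (by simp)
  replace e1 := le_of_abs_le e1
  replace e2 := le_of_abs_le e2
  obtain ⟨hxy, hxz, hxw, hyz, hyw, hzw⟩ := hD
  rw [hf ⟨hxz, hxy, hxw, hyz.symm, hzw, hyw⟩] at e1
  rw [hf ⟨hxw, hxy, hxz, hyw.symm, hzw.symm, hyz⟩] at e2
  rw [hf hd]
  obtain ⟨hab, hau, hav, hbu, hbv, huv⟩ := hd
  rw [hf ⟨hbu, hab.symm, hbv, hau.symm, huv, hav⟩, hf ⟨hbv, hab.symm, hbu, hav.symm, huv.symm, hau⟩]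
  rcases ha with ha | ha | ha | ha <;> rcases hb with hb | hb | hb | hb <;>
    (first
      | exact absurd (ha.trans hb.symm) hab
      | skip) <;>
    rcases hu with hu | hu | hu | hu <;>
    (first
      | exact absurd (ha.trans hu.symm) hau
      | exact absurd (hb.trans hu.symm) hbu
      | skip) <;>
    rcases hv with hv | hv | hv | hv <;>
    (first
      | exact absurd (ha.trans hv.symm) hav
      | exact absurd (hb.trans hv.symm) hbv
      | exact absurd (hu.trans hv.symm) huv
      | (rw [ha, hb, hu, hv]
         try simp only [s1, s2, s3]
         first
           | exact Or.inl ⟨e1, e2⟩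
           | exact Or.inl ⟨e2, e1⟩
           | exact Or.inr (Or.inl ⟨e1, e2⟩)
           | exact Or.inr (Or.inl ⟨e2, e1⟩)
           | exact Or.inr (Or.inr ⟨e1, e2⟩)
           | exact Or.inr (Or.inr ⟨e2, e1⟩)))

/-- The signed distance from the projection of `u` to the projection of `v` on the line `b a`,
positive in the direction of `a`. -/
def lineShift {M : Type*} (cr : M → M → M → M → ℝ) (a b u v : M) : ℝ :=
  cr b u a v - cr b v a u

lemma lineShift_swap {M : Type*} {cr : M → M → M → M → ℝ} (a b u v : M) :
    lineShift cr a b v u = -lineShift cr a b u v := by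
  simp [lineShift]

lemma IsCrossratio.lineShift_swap_ends {M : Type*} {cr : M → M → M → M → ℝ}
    (hcr : IsCrossratio cr) {a b u v : M} (hd : PDist4 a b u v) :
    lineShift cr b a u v = -lineShift cr a b u v := by
  obtain ⟨hab, hau, hav, hbu, hbv, huv⟩ := hd
  simp only [lineShift]
  rw [(hcr a u b v ⟨hau, hab, hav, hbu.symm, huv, hbv⟩).2.2,
    (hcr a v b u ⟨hav, hab, hau, hbv.symm, huv.symm, hbu⟩).2.2]
  ring

/-- A crossratio is close to the signed distance when the latter is not very negative. -/
lemma IsHyperbolicCR.abs_cr_sub_lineShift_le {M : Type*} {cr : M → M → M → M → ℝ} {k : ℝ}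
    (hcr : IsCrossratio cr) (hhyp : IsHyperbolicCR cr k) {a b u v : M} (hd : PDist4 a b u v)
    {C : ℝ} (hC : 0 ≤ C) (h : -C ≤ lineShift cr a b u v) :
    |cr b u a v - lineShift cr a b u v| ≤ k + C := by
  have hsmall := hhyp.two_small hcr hd
  obtain ⟨hab, hau, hav, hbu, hbv, huv⟩ := hd
  have hn := (hcr b v a u ⟨hbv, hab.symm, hbu, hav.symm, huv.symm, hau⟩).1
  simp only [lineShift] at *
  rw [abs_le]
  rcases hsmall with h' | h' | h' <;> constructor <;> linarith

/-- There are points of `M` whose projection to the line `b a` lies about `i` units past that of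
`c` in the direction of `a`. -/
lemma exists_lineShift_near_nat {M : Type*} {cr : M → M → M → M → ℝ} {k : ℝ}
    (hcr : IsCrossratio cr) (hhyp : IsHyperbolicCR cr k) (hpath : IsPathCR cr k)
    (hperf : IsPerfectCR cr) {a b c : M} (hab : a ≠ b) (hac : a ≠ c) (hbc : b ≠ c)
    {i : ℕ} (hi : 0 < i) (hik : 2 * k < i) :
    ∃ u, u ≠ a ∧ u ≠ b ∧ u ≠ c ∧ |lineShift cr a b c u - i| ≤ 2 * k := by
  obtain ⟨s, hs, hlim⟩ := hperf a b c hab hac hbc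
  obtain ⟨m, hm⟩ := (hlim.eventually_gt_atTop (i + k)).exists
  obtain ⟨hsa, hsb, hsc⟩ := hs m
  obtain ⟨n, u, hu0, hun, hinj, huab, hu⟩ :=
    hpath b c a (s m) ⟨hbc, hab.symm, hsb.symm, hac.symm, hsc.symm, hsa.symm⟩
  have hlast : (0 : Fin (n + 1)) < Fin.last n := by
    rw [Fin.lt_def]
    rcases Nat.eq_zero_or_pos n with rfl | hn
    · exact absurd (hun.symm.trans hu0) hsc
    · simpa using hn
  have hlen := hu 0 (Fin.last n) hlast
  rw [hu0, hun, abs_le] at hlen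
  simp only [Fin.val_last, Fin.val_zero, Nat.cast_zero, sub_zero] at hlen
  have hin : i < n := by
    have : (i : ℝ) < n := by linarith
    exact_mod_cast this
  let j : Fin (n + 1) := ⟨i, by omega⟩
  have hj : (0 : Fin (n + 1)) < j := hi
  have hjc : u j ≠ c := by
    rw [← hu0]
    exact fun h => hj.ne' (hinj h)
  have hdj := hu 0 j hj
  rw [hu0] at hdj
  simp only [j, Fin.val_zero, Nat.cast_zero, sub_zero] at hdj
  have hd : PDist4 a b c (u j) := ⟨hab, hac, (huab j).2.symm, hbc, (huab j).1.symm, hjc.symm⟩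
  refine ⟨u j, (huab j).2, (huab j).1, hjc, ?_⟩
  have hn := (hcr b (u j) a c ⟨hd.2.2.2.2.1, hab.symm, hbc, (huab j).2, hjc, hac⟩).1
  have hsmall := hhyp.two_small hcr hd
  simp only [lineShift, j] at *
  rw [abs_le] at *
  rcases hsmall with h | h | h <;> constructor <;> linarith

/-- Every integer is coarsely the signed distance from `c` of infinitely many points. -/
lemma infinite_lineShift_near {M : Type*} {cr : M → M → M → M → ℝ} {k : ℝ} (hk : 0 ≤ k)
    (hcr : IsCrossratio cr) (hhyp : IsHyperbolicCR cr k) (hpath : IsPathCR cr k)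
    (hperf : IsPerfectCR cr) {a b c : M} (hab : a ≠ b) (hac : a ≠ c) (hbc : b ≠ c)
    {N : ℕ} (hN : 2 * k < N) (i : ℤ) :
    {v : M | v ≠ a ∧ v ≠ b ∧ v ≠ c ∧ |lineShift cr a b c v - i| ≤ 9 * k + N}.Infinite := by
  have hN0 : 0 < N := by
    have : (0 : ℝ) < N := by linarith
    exact_mod_cast this
  have hu : ∃ u, u ≠ a ∧ u ≠ b ∧ u ≠ c ∧ |lineShift cr a b c u - i| ≤ 2 * k + N := by
    rcases le_total 0 i with hi | hi
    · obtain ⟨n, rfl⟩ := Int.eq_ofNat_of_zero_le hi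
      obtain ⟨u, hua, hub, huc, h⟩ := exists_lineShift_near_nat hcr hhyp hpath hperf hab hac hbc
        (i := n + N) (by omega) (by push_cast; linarith [n.cast_nonneg (α := ℝ)])
      refine ⟨u, hua, hub, huc, ?_⟩
      push_cast at h ⊢
      rw [abs_le] at *
      constructor <;> linarith
    · obtain ⟨n, hn⟩ := Int.eq_ofNat_of_zero_le (neg_nonneg.2 hi)
      obtain rfl : i = -(n : ℤ) := by omega
      obtain ⟨u, hub, hua, huc, h⟩ := exists_lineShift_near_nat hcr hhyp hpath hperf hab.symm hbc hac
        (i := n + N) (by omega) (by push_cast; linarith [n.cast_nonneg (α := ℝ)])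
      refine ⟨u, hua, hub, huc, ?_⟩
      rw [hcr.lineShift_swap_ends ⟨hab, hac, hua.symm, hbc, hub.symm, huc.symm⟩] at h
      push_cast at h ⊢
      rw [abs_le] at *
      constructor <;> linarith
  obtain ⟨u, hua, hub, huc, hui⟩ := hu
  obtain ⟨s, hs, hlim⟩ := hperf u a b hua hub hab
  have hmem : ∀ᶠ n in atTop,
      s n ∈ {v : M | v ≠ a ∧ v ≠ b ∧ v ≠ c ∧ |lineShift cr a b c v - i| ≤ 9 * k + N} := by
    filter_upwards [hlim.eventually_gt_atTop k, hlim.eventually_gt_atTop (cr a b u c)] with n hn hnc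
    obtain ⟨hsu, hsa, hsb⟩ := hs n
    have hsc : s n ≠ c := fun h => by
      rw [h] at hnc
      exact lt_irrefl _ hnc
    refine ⟨hsa, hsb, hsc, ?_⟩
    have hd : PDist4 a b u (s n) := ⟨hab, hua.symm, hsa.symm, hub.symm, hsb.symm, hsu.symm⟩
    have hn1 := (hcr b u a (s n) ⟨hub.symm, hab.symm, hsb.symm, hua, hsu.symm, hsa.symm⟩).1
    have hn2 := (hcr b (s n) a u ⟨hsb.symm, hab.symm, hub.symm, hsa, hsu, hua.symm⟩).1
    have hcoc := hhyp.cocycle hk hcr (a := a) (b := b) (p := c) (q := u) (r := s n)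
      ⟨⟨hab, hac, hua.symm, hbc, hub.symm, huc.symm⟩, hsa.symm, hsb.symm, hsc.symm, hsu.symm⟩
    simp only [lineShift] at *
    rw [abs_le] at *
    rcases hhyp.two_small hcr hd with h | h | h
    · constructor <;> linarith
    · linarith
    · linarith
  intro hfin
  obtain ⟨B, hB⟩ := (hfin.image (fun v => cr a b u v)).bddAbove
  obtain ⟨n, hn, hnB⟩ := (hmem.and (hlim.eventually_gt_atTop B)).exists
  exact absurd (hB ⟨s n, hn, rfl⟩) (not_le.2 hnB)

/-- A countable family of infinite sets has an injective choice function. -/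
lemma exists_injective_forall_mem_of_infinite {ι α : Type*} [Countable ι] {S : ι → Set α}
    (hS : ∀ i, (S i).Infinite) : ∃ x : ι → α, Function.Injective x ∧ ∀ i, x i ∈ S i := by
  classical
  obtain ⟨e, he⟩ := exists_injective_nat ι
  choose t htS hcard using fun i => (hS i).exists_subset_card_eq (e i + 1)
  obtain ⟨x, hx, hxt⟩ := (Finset.all_card_le_biUnion_card_iff_exists_injective t).1 fun F => by
    rcases F.eq_empty_or_nonempty with rfl | hF
    · simp
    obtain ⟨i, hi, hmax⟩ := F.exists_max_image e hF
    calc F.card = (F.image e).card := (Finset.card_image_of_injective _ he).symm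
      _ ≤ (Finset.range (e i + 1)).card := Finset.card_le_card fun n hn => by
          obtain ⟨j, hj, rfl⟩ := Finset.mem_image.1 hn
          exact Finset.mem_range.2 (Nat.lt_succ_of_le (hmax j hj))
      _ = (t i).card := by rw [Finset.card_range, hcard]
      _ ≤ (F.biUnion t).card := Finset.card_le_card (Finset.subset_biUnion_of_mem t hi)
  exact ⟨x, hx, fun i => htS i (hxt i)⟩

/-- for a perfect `k`-hyperbolic path crossratio on `M` there is a constant `p`
such that for all pairwise distinct `a, b, c` there is a bi-infinite sequence `(x_i)_{i ∈ ℤ}`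
of pairwise distinct points of `M \ {a, b}` with `x₀ = c` and `(b x_i | a x_j) ≃_p j - i` for
all `i < j`. -/
theorem exists_biinfinite_geodesic_of_path_crossratio
    {M : Type*} (cr : M → M → M → M → ℝ) (k : ℝ) (hk : 0 ≤ k)
    (hcr : IsCrossratio cr) (hhyp : IsHyperbolicCR cr k) (hpath : IsPathCR cr k)
    (hperf : IsPerfectCR cr) :
    ∃ p : ℝ, 0 ≤ p ∧ ∀ a b c : M, a ≠ b → a ≠ c → b ≠ c →
      ∃ x : ℤ → M, Function.Injective x ∧ (∀ i : ℤ, x i ≠ a ∧ x i ≠ b) ∧ x 0 = c ∧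
        ∀ i j : ℤ, i < j → |cr b (x i) a (x j) - ((j : ℝ) - (i : ℝ))| ≤ p := by
  obtain ⟨N, hN⟩ := exists_nat_gt (2 * k)
  have hNnn : (0 : ℝ) ≤ N := N.cast_nonneg
  refine ⟨49 * k + 4 * N, by positivity, fun a b c hab hac hbc => ?_⟩
  obtain ⟨y, hyinj, hy⟩ := exists_injective_forall_mem_of_infinite fun i : ℤ =>
    infinite_lineShift_near hk hcr hhyp hpath hperf hab hac hbc hN i
  have hyc : ∀ i, y i ≠ c := fun i => (hy i).2.2.1
  let x : ℤ → M := Function.update y 0 c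
  have hx0 : x 0 = c := Function.update_self ..
  have hxy : ∀ {i}, i ≠ 0 → x i = y i := fun h => Function.update_of_ne h ..
  have hxinj : Function.Injective x := by
    intro i j hij
    by_cases hi : i = 0 <;> by_cases hj : j = 0
    · rw [hi, hj]
    · rw [hi, hx0, hxy hj] at hij
      exact absurd hij.symm (hyc j)
    · rw [hj, hx0, hxy hi] at hij
      exact absurd hij (hyc i)
    · rw [hxy hi, hxy hj] at hij
      exact hyinj hij
  have hxab : ∀ i, x i ≠ a ∧ x i ≠ b := by
    intro i
    by_cases hi : i = 0
    · rw [hi, hx0]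
      exact ⟨hac.symm, hbc.symm⟩
    · rw [hxy hi]
      exact ⟨(hy i).1, (hy i).2.1⟩
  refine ⟨x, hxinj, hxab, hx0, fun i j hij => ?_⟩
  have hshift : |lineShift cr a b (x i) (x j) - ((j : ℝ) - i)| ≤ 24 * k + 2 * N := by
    by_cases hi : i = 0
    · have hj : j ≠ 0 := by omega
      have := (hy j).2.2.2
      rw [hi, hx0, hxy hj, Int.cast_zero, sub_zero]
      linarith
    by_cases hj : j = 0
    · have := (hy i).2.2.2
      rw [hj, hx0, hxy hi, lineShift_swap, Int.cast_zero, ← abs_neg]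
      ring_nf at this ⊢
      linarith
    have h1 := (hy i).2.2.2
    have h2 := (hy j).2.2.2
    rw [← hxy hi] at h1
    rw [← hxy hj] at h2
    have hcoc := hhyp.cocycle hk hcr (a := a) (b := b) (p := c) (q := x i) (r := x j)
      ⟨⟨hab, hac, (hxab i).1.symm, hbc, (hxab i).2.symm, by rw [hxy hi]; exact (hyc i).symm⟩,
        (hxab j).1.symm, (hxab j).2.symm, by rw [hxy hj]; exact (hyc j).symm, hxinj.ne hij.ne⟩
    simp only [lineShift] at *
    rw [abs_le] at *
    constructor <;> linarith
  have hij' : (i : ℝ) < j := by exact_mod_cast hij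
  have hclose := hhyp.abs_cr_sub_lineShift_le hcr (a := a) (b := b) (u := x i) (v := x j)
    ⟨hab, (hxab i).1.symm, (hxab j).1.symm, (hxab i).2.symm, (hxab j).2.symm, hxinj.ne hij.ne⟩
    (C := 24 * k + 2 * N) (by positivity) (by linarith [(abs_le.1 hshift).1])
  calc |cr b (x i) a (x j) - ((j : ℝ) - i)|
      ≤ |cr b (x i) a (x j) - lineShift cr a b (x i) (x j)| +
        |lineShift cr a b (x i) (x j) - ((j : ℝ) - i)| := abs_sub_le ..
    _ ≤ 49 * k + 4 * N := by linarith
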